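/- arXiv:2504.06048 — 2 statements merged into one kernel-verified Lean document; each statement's English description precedes it below -/
import Mathlib

section
/- (Eq. 2, posterior policy as a tilted conditional) Fix 1 ≤ t ≤ T and a state s with Σ_{h : s_t(h) = s} p_π(h) > 0. Under the tilted weights ρ_t(h) = p_π(h)·exp(Σ_{j=t}^{T} R(s_j,a_j)), the conditional probability of A_t = a given S_t = s, namely [ Σ_{h : s_t(h) = s, a_t(h) = a} ρ_t(h) ] / [ Σ_{h : s_t(h) = s} ρ_t(h) ], equals the posterior policy value q^post_t(s,a). -/
/-- Probability of a trajectory `x` (index `i : Fin T` represents time `i+1`, so times run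
over `1,…,T`) under initial distribution `p₁`, transition kernel `P` and policy `q`:
`p_q(h) = p₁(s₁) · ∏_{t=1}^T q_t(s_t,a_t) · ∏_{t=2}^T P(s_{t−1},a_{t−1},s_t)`. -/
noncomputable def pTraj {S A : Type} (T : ℕ) (p₁ : S → ℝ) (P : S → A → S → ℝ)
    (q : ℕ → S → A → ℝ) (x : Fin T → S × A) : ℝ :=
  (if h0 : 0 < T then p₁ (x ⟨0, h0⟩).1 else 1) *
    (∏ i : Fin T, q (i.1 + 1) (x i).1 (x i).2) *
    ∏ i : Fin T, if hlt : i.1 + 1 < T then P (x i).1 (x i).2 (x ⟨i.1 + 1, hlt⟩).1 else 1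

/-- Return of a trajectory: `R(h) = ∑_{t=1}^T R(s_t,a_t)`. -/
noncomputable def ret {S A : Type} (T : ℕ) (R : S → A → ℝ) (x : Fin T → S × A) : ℝ :=
  ∑ i : Fin T, R (x i).1 (x i).2

/-- Value of a policy: `J(q) = ∑_h p_q(h)·R(h)`. -/
noncomputable def Jval {S A : Type} [Fintype S] [Fintype A] (T : ℕ) (p₁ : S → ℝ) (P : S → A → S → ℝ)
    (R : S → A → ℝ) (q : ℕ → S → A → ℝ) : ℝ :=
  ∑ x : Fin T → S × A, pTraj T p₁ P q x * ret T R x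

/-- KL-regularized objective of `q` relative to the prior `π`:
`L(q) = ∑_{h : p_q(h)>0} p_q(h)·(R(h) + ∑_{t=1}^T log(π_t(s_t,a_t)/q_t(s_t,a_t)))`. -/
noncomputable def Lval {S A : Type} [Fintype S] [Fintype A] (T : ℕ) (p₁ : S → ℝ) (P : S → A → S → ℝ)
    (R : S → A → ℝ) (π q : ℕ → S → A → ℝ) : ℝ :=
  ∑ x : Fin T → S × A,
    if 0 < pTraj T p₁ P q x then
      pTraj T p₁ P q x * (ret T R x +
        ∑ i : Fin T,
          Real.log (π (i.1 + 1) (x i).1 (x i).2 / q (i.1 + 1) (x i).1 (x i).2))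
    else 0

/-- `q` is a (nonstationary) policy for times `1,…,T`. -/
def IsPolicy {S A : Type} [Fintype A] (T : ℕ) (q : ℕ → S → A → ℝ) : Prop :=
  ∀ t ∈ Finset.Icc 1 T, ∀ s : S, (∀ a : A, 0 ≤ q t s a) ∧ (∑ a : A, q t s a) = 1

/-- `π` has full support: `π_t(s,a) > 0` for all `t,s,a`. -/
def FullSupport {S A : Type} (T : ℕ) (π : ℕ → S → A → ℝ) : Prop :=
  ∀ t ∈ Finset.Icc 1 T, ∀ (s : S) (a : A), 0 < π t s a

/-- `q` is absolutely continuous w.r.t. `π`: `q_t(s,a) > 0 → π_t(s,a) > 0`. -/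
def AbsCont {S A : Type} (T : ℕ) (q π : ℕ → S → A → ℝ) : Prop :=
  ∀ t ∈ Finset.Icc 1 T, ∀ (s : S) (a : A), 0 < q t s a → 0 < π t s a

/-- KL divergence on a finite type: `KL(u‖v) = ∑_{x : u(x)>0} u(x)·log(u(x)/v(x))`. -/
noncomputable def KL {X : Type} [Fintype X] (u v : X → ℝ) : ℝ :=
  ∑ x : X, if 0 < u x then u x * Real.log (u x / v x) else 0

theorem pTraj_nonneg {S A : Type} [Fintype A] {T : ℕ} {p₁ : S → ℝ} {P : S → A → S → ℝ}
    {q : ℕ → S → A → ℝ} (hp₁ : ∀ s, 0 ≤ p₁ s) (hP : ∀ s a s', 0 ≤ P s a s')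
    (hq : IsPolicy T q) (x : Fin T → S × A) : 0 ≤ pTraj T p₁ P q x := by
  unfold pTraj
  refine mul_nonneg (mul_nonneg ?_ (Finset.prod_nonneg fun i _ => ?_))
    (Finset.prod_nonneg fun i _ => ?_)
  · split_ifs
    · exact hp₁ _
    · exact zero_le_one
  · exact (hq (i.1 + 1) (Finset.mem_Icc.2 ⟨by omega, i.2⟩) _).1 _
  · split_ifs
    · exact hP _ _ _
    · exact zero_le_one

/-- Appending a step to a nonempty trajectory multiplies its probability by the transition
probability into the new state and by the policy's probability of the new action. -/
theorem pTraj_snoc {S A : Type} (n : ℕ) (p₁ : S → ℝ) (P : S → A → S → ℝ)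
    (q : ℕ → S → A → ℝ) (y : Fin (n + 1) → S × A) (z : S × A) :
    pTraj (n + 2) p₁ P q (Fin.snoc (α := fun _ => S × A) y z) =
      pTraj (n + 1) p₁ P q y * P (y (Fin.last n)).1 (y (Fin.last n)).2 z.1 *
        q (n + 2) z.1 z.2 := by
  have hinit : (Fin.snoc (α := fun _ => S × A) y z : Fin (n + 2) → S × A) ⟨0, by omega⟩ =
      y ⟨0, by omega⟩ :=
    Fin.snoc_castSucc (α := fun _ => S × A) z y ⟨0, by omega⟩
  have htrans : (∏ i : Fin (n + 2), if hlt : i.1 + 1 < n + 2 then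
        P (Fin.snoc (α := fun _ => S × A) y z i).1 (Fin.snoc (α := fun _ => S × A) y z i).2
          (Fin.snoc (α := fun _ => S × A) y z ⟨i.1 + 1, hlt⟩).1 else 1) =
      (∏ i : Fin (n + 1), if hlt : i.1 + 1 < n + 1 then
        P (y i).1 (y i).2 (y ⟨i.1 + 1, hlt⟩).1 else 1) *
        P (y (Fin.last n)).1 (y (Fin.last n)).2 z.1 := by
    rw [Fin.prod_univ_castSucc, Fin.prod_univ_castSucc, Fin.prod_univ_castSucc]
    have hlast : (Fin.snoc (α := fun _ => S × A) y z : Fin (n + 2) → S × A)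
        ⟨n + 1, by omega⟩ = z := Fin.snoc_last (α := fun _ => S × A) z y
    have hmid : ∀ i : Fin n, (Fin.snoc (α := fun _ => S × A) y z : Fin (n + 2) → S × A)
        ⟨i.1 + 1, by omega⟩ = y ⟨i.1 + 1, by omega⟩ :=
      fun i => Fin.snoc_castSucc (α := fun _ => S × A) z y ⟨i.1 + 1, by omega⟩
    simp [Fin.snoc_castSucc, hlast, hmid]
  unfold pTraj
  rw [htrans, Fin.prod_univ_castSucc]
  simp only [hinit, Fin.snoc_castSucc, Fin.snoc_last, Fin.val_castSucc, Fin.val_last]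
  rw [dif_pos (by omega), dif_pos (by omega)]
  ring

/-- The probability of a trajectory depends on the last action only through the factor
contributed by the policy. -/
theorem exists_pTraj_snoc_eq_mul {S A : Type} (n : ℕ) (p₁ : S → ℝ) (P : S → A → S → ℝ)
    (q : ℕ → S → A → ℝ) :
    ∃ c : (Fin n → S × A) → S → ℝ, ∀ (y : Fin n → S × A) (z : S × A),
      pTraj (n + 1) p₁ P q (Fin.snoc (α := fun _ => S × A) y z) =
        c y z.1 * q (n + 1) z.1 z.2 := by
  cases n with
  | zero =>
    refine ⟨fun _ s => p₁ s, fun y z => ?_⟩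
    have hz : (Fin.snoc (α := fun _ => S × A) y z : Fin 1 → S × A) 0 = z :=
      Fin.snoc_last (α := fun _ => S × A) z y
    simp [pTraj, hz]
  | succ n =>
    exact ⟨fun y s => pTraj (n + 1) p₁ P q y * P (y (Fin.last n)).1 (y (Fin.last n)).2 s,
      pTraj_snoc n p₁ P q⟩

theorem Fin.sum_univ_snoc {X M : Type*} [Fintype X] [AddCommMonoid M] (n : ℕ)
    (f : (Fin (n + 1) → X) → M) :
    ∑ x, f x = ∑ y : Fin n → X, ∑ z : X, f (Fin.snoc (α := fun _ => X) y z) := by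
  rw [← (Fin.snocEquiv fun _ => X).sum_comp f, Fintype.sum_prod_type_right]
  rfl

/-- If `B` solves the backward recursion of exponentiated values, summing out the steps after
time `n + 1` of the tilted weights leaves the factor `B (n + 1)` at the last step. -/
theorem sum_tilted_eq_sum_truncated {S A : Type} [Fintype S] [Fintype A]
    (p₁ : S → ℝ) (P : S → A → S → ℝ) (R : S → A → ℝ) (q : ℕ → S → A → ℝ)
    (B : ℕ → S × A → ℝ) (g : S × A → ℝ) (k N : ℕ) (hkN : k ≤ N)
    (hB : ∀ n < N, ∀ z, B (n + 1) z = ∑ s', P z.1 z.2 s' *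
      ∑ a', q (n + 2) s' a' * (Real.exp (R s' a') * B (n + 2) (s', a'))) :
    (∑ x : Fin (N + 1) → S × A, g (x ⟨k, by omega⟩) * (pTraj (N + 1) p₁ P q x *
        Real.exp (∑ i : Fin (N + 1), if k + 1 ≤ i.1 + 1 then R (x i).1 (x i).2 else 0) *
        B (N + 1) (x (Fin.last N)))) =
      ∑ x : Fin (k + 1) → S × A, g (x (Fin.last k)) * (pTraj (k + 1) p₁ P q x *
        Real.exp (∑ i : Fin (k + 1), if k + 1 ≤ i.1 + 1 then R (x i).1 (x i).2 else 0) *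
        B (k + 1) (x (Fin.last k))) := by
  induction N, hkN using Nat.le_induction with
  | base => rfl
  | succ N hkN ih =>
    rw [← ih fun n hn => hB n (by omega), Fin.sum_univ_snoc]
    refine Finset.sum_congr rfl fun y _ => ?_
    have hk : ∀ z, (Fin.snoc (α := fun _ => S × A) y z : Fin (N + 2) → S × A) ⟨k, by omega⟩ =
        y ⟨k, by omega⟩ :=
      fun z => Fin.snoc_castSucc (α := fun _ => S × A) z y ⟨k, by omega⟩
    have hexp : ∀ z, Real.exp (∑ i : Fin (N + 2), if k + 1 ≤ i.1 + 1 then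
          R (Fin.snoc (α := fun _ => S × A) y z i).1
            (Fin.snoc (α := fun _ => S × A) y z i).2 else 0) =
        Real.exp (∑ i : Fin (N + 1), if k + 1 ≤ i.1 + 1 then R (y i).1 (y i).2 else 0) *
          Real.exp (R z.1 z.2) := by
      intro z
      rw [Fin.sum_univ_castSucc, Real.exp_add]
      simp only [Fin.snoc_castSucc, Fin.snoc_last, Fin.val_castSucc, Fin.val_last]
      rw [if_pos (by omega : k + 1 ≤ N + 1 + 1)]
    rw [hB N (by omega), Fintype.sum_prod_type]
    simp only [hk, hexp, pTraj_snoc, Fin.snoc_last, Finset.mul_sum]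
    refine Finset.sum_congr rfl fun s' _ => Finset.sum_congr rfl fun a' _ => ?_
    ring

/-- Eq. 2, posterior policy as a tilted conditional: under the tilted weights
`ρ_t(h) = p_π(h)·exp(∑_{j=t}^T R(s_j,a_j))`, the conditional probability of `A_t = a` given
`S_t = s` equals the posterior policy `q^post_t(s,a) = π_t(s,a)·exp(Q_t(s,a) − V_t(s))`. -/
theorem stmt_4 {S A : Type} [Fintype S] [Fintype A] [DecidableEq S] [DecidableEq A]
    [Nonempty S] [Nonempty A]
    (T : ℕ) (hT : 1 ≤ T)
    (p₁ : S → ℝ) (hp₁ : ∀ s, 0 ≤ p₁ s) (hp₁sum : (∑ s : S, p₁ s) = 1)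
    (P : S → A → S → ℝ) (hP : ∀ s a s', 0 ≤ P s a s')
    (hPsum : ∀ s a, (∑ s' : S, P s a s') = 1)
    (R : S → A → ℝ)
    (π : ℕ → S → A → ℝ) (hπ : IsPolicy T π) (hπpos : FullSupport T π)
    (V : ℕ → S → ℝ) (Q : ℕ → S → A → ℝ)
    (hVT : ∀ s, V (T + 1) s = 0)
    (hQ : ∀ t ∈ Finset.Icc 1 T, ∀ (s : S) (a : A),
      Q t s a = R s a + Real.log (∑ s' : S, P s a s' * Real.exp (V (t + 1) s')))
    (hV : ∀ t ∈ Finset.Icc 1 T, ∀ s : S,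
      V t s = Real.log (∑ a : A, π t s a * Real.exp (Q t s a)))
    (t : ℕ) (ht1 : 1 ≤ t) (ht2 : t ≤ T) (s : S)
    (hpos : 0 < ∑ x ∈ Finset.univ.filter
        (fun x : Fin T → S × A => (x ⟨t - 1, by omega⟩).1 = s), pTraj T p₁ P π x)
    (a : A) :
    (∑ x ∈ Finset.univ.filter (fun x : Fin T → S × A =>
          (x ⟨t - 1, by omega⟩).1 = s ∧ (x ⟨t - 1, by omega⟩).2 = a),
        pTraj T p₁ P π x *
          Real.exp (∑ i : Fin T, if t ≤ i.1 + 1 then R (x i).1 (x i).2 else 0)) /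
      (∑ x ∈ Finset.univ.filter (fun x : Fin T → S × A => (x ⟨t - 1, by omega⟩).1 = s),
        pTraj T p₁ P π x *
          Real.exp (∑ i : Fin T, if t ≤ i.1 + 1 then R (x i).1 (x i).2 else 0)) =
      π t s a * Real.exp (Q t s a - V t s) := by
  obtain ⟨N, rfl⟩ : ∃ N, T = N + 1 := ⟨T - 1, by omega⟩
  obtain ⟨k, rfl⟩ : ∃ k, t = k + 1 := ⟨t - 1, by omega⟩
  have hBpos : ∀ m (z : S × A), 0 < ∑ s', P z.1 z.2 s' * Real.exp (V (m + 1) s') := by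
    intro m z
    have hnn : ∀ s' ∈ Finset.univ, 0 ≤ P z.1 z.2 s' * Real.exp (V (m + 1) s') :=
      fun s' _ => mul_nonneg (hP _ _ _) (Real.exp_pos _).le
    refine (Finset.sum_nonneg hnn).lt_of_ne fun h => ?_
    have hz := (Finset.sum_eq_zero_iff_of_nonneg hnn).1 h.symm
    have hPz : ∀ s' ∈ Finset.univ, P z.1 z.2 s' = 0 := fun s' hs' =>
      (mul_eq_zero.1 (hz s' hs')).resolve_right (Real.exp_pos _).ne'
    exact zero_ne_one ((Finset.sum_eq_zero hPz).symm.trans (hPsum z.1 z.2))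
  set B : ℕ → S × A → ℝ := fun m z => ∑ s', P z.1 z.2 s' * Real.exp (V (m + 1) s') with hBdef
  have hexpQ : ∀ m ∈ Finset.Icc 1 (N + 1), ∀ s a,
      Real.exp (Q m s a) = Real.exp (R s a) * B m (s, a) := by
    intro m hm s a
    rw [hQ m hm, Real.exp_add, Real.exp_log (hBpos m (s, a))]
  have hexpV : ∀ m ∈ Finset.Icc 1 (N + 1), ∀ s,
      Real.exp (V m s) = ∑ a, π m s a * Real.exp (Q m s a) := by
    intro m hm s
    rw [hV m hm, Real.exp_log]
    exact Finset.sum_pos (fun a _ => mul_pos (hπpos m hm s a) (Real.exp_pos _))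
      Finset.univ_nonempty
  have hBlast : ∀ z, B (N + 1) z = 1 := by
    intro z
    simp [hBdef, hVT, hPsum]
  have hBrec : ∀ n < N, ∀ z, B (n + 1) z = ∑ s', P z.1 z.2 s' *
      ∑ a', π (n + 2) s' a' * (Real.exp (R s' a') * B (n + 2) (s', a')) := by
    intro n hn z
    have hm : n + 2 ∈ Finset.Icc 1 (N + 1) := Finset.mem_Icc.2 ⟨by omega, by omega⟩
    refine Finset.sum_congr rfl fun s' _ => ?_
    rw [hexpV (n + 2) hm]
    simp only [hexpQ (n + 2) hm]
  have hk : k + 1 ∈ Finset.Icc 1 (N + 1) := Finset.mem_Icc.2 ⟨ht1, ht2⟩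
  obtain ⟨c, hc⟩ := exists_pTraj_snoc_eq_mul k p₁ P π
  have hmarg : ∀ g : S × A → ℝ,
      (∑ x : Fin (N + 1) → S × A, g (x ⟨k, by omega⟩) * (pTraj (N + 1) p₁ P π x *
        Real.exp (∑ i : Fin (N + 1), if k + 1 ≤ i.1 + 1 then R (x i).1 (x i).2 else 0))) =
      ∑ z : S × A, g z * ((∑ y, c y z.1) *
        (π (k + 1) z.1 z.2 * Real.exp (Q (k + 1) z.1 z.2))) := by
    intro g
    have h := sum_tilted_eq_sum_truncated p₁ P R π B g k N (by omega) hBrec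
    simp only [hBlast, mul_one] at h
    rw [h, Fin.sum_univ_snoc, Finset.sum_comm]
    refine Finset.sum_congr rfl fun z _ => ?_
    rw [Finset.sum_mul, Finset.mul_sum]
    refine Finset.sum_congr rfl fun y _ => ?_
    have hearly : ∀ i : Fin k, ¬ k + 1 ≤ i.1 + 1 := fun i => by omega
    rw [Fin.sum_univ_castSucc]
    simp only [hc, hexpQ _ hk, Fin.snoc_last, Fin.val_castSucc, Fin.val_last, hearly, if_false,
      Finset.sum_const_zero, zero_add, le_refl, if_true]
    ring
  have hcond : ∀ (p : S × A → Prop) [DecidablePred p],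
      (∑ x ∈ Finset.univ.filter (fun x : Fin (N + 1) → S × A => p (x ⟨k, by omega⟩)),
        pTraj (N + 1) p₁ P π x *
          Real.exp (∑ i : Fin (N + 1), if k + 1 ≤ i.1 + 1 then R (x i).1 (x i).2 else 0)) =
      ∑ z ∈ Finset.univ.filter p, (∑ y, c y z.1) *
        (π (k + 1) z.1 z.2 * Real.exp (Q (k + 1) z.1 z.2)) := by
    intro p _
    rw [Finset.sum_filter, Finset.sum_filter]
    simpa only [ite_mul, one_mul, zero_mul] using hmarg fun z => if p z then 1 else 0
  have hnum := hcond fun z => z.1 = s ∧ z.2 = a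
  have hden := hcond fun z => z.1 = s
  have hnumset : (Finset.univ.filter fun z : S × A => z.1 = s ∧ z.2 = a) = {(s, a)} := by
    ext z
    simp [Prod.ext_iff]
  rw [hnumset, Finset.sum_singleton] at hnum
  rw [Finset.sum_filter (fun z : S × A => z.1 = s), Fintype.sum_prod_type,
    Finset.sum_comm] at hden
  simp only [Finset.sum_ite_eq', Finset.mem_univ, if_true] at hden
  rw [← Finset.mul_sum, ← hexpV _ hk] at hden
  have hdenpos : 0 < ∑ x ∈ Finset.univ.filter
      (fun x : Fin (N + 1) → S × A => (x ⟨k, by omega⟩).1 = s), pTraj (N + 1) p₁ P π x *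
        Real.exp (∑ i : Fin (N + 1), if k + 1 ≤ i.1 + 1 then R (x i).1 (x i).2 else 0) := by
    obtain ⟨x, hx, hxpos⟩ := Finset.exists_lt_of_sum_lt
      (show ∑ x ∈ Finset.univ.filter
        (fun x : Fin (N + 1) → S × A => (x ⟨k, by omega⟩).1 = s), (0 : ℝ) < _ by
          simpa using hpos)
    exact Finset.sum_pos' (fun y _ => mul_nonneg (pTraj_nonneg hp₁ hP hπ y) (Real.exp_pos _).le)
      ⟨x, hx, mul_pos hxpos (Real.exp_pos _)⟩
  have hC : (∑ y, c y s) ≠ 0 := left_ne_zero_of_mul (hden ▸ hdenpos.ne')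
  refine (congrArg₂ (· / ·) hnum hden).trans ?_
  simp only [Real.exp_sub]
  field_simp
end

section
/- (Markov property of the posterior action conditional, justifying the independence assumption A_t ⟂ O_{<t} | S_t of Definition 2.1) Fix 1 ≤ t ≤ T and a history prefix (s_1,a_1,…,s_{t−1},a_{t−1},s_t) whose probability under p_π is positive. Under the fully tilted weights ρ(h) = p_π(h)·exp(R(h)), the conditional probability of A_t = a given that the trajectory begins with this prefix equals q^post_t(s_t, a); in particular it depends on the prefix only through the current state s_t. -/
lemma sum_fin_succ_cons {B : Type} [Fintype B] (n : ℕ) (f : (Fin (n + 1) → B) → ℝ) :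
    ∑ x, f x = ∑ z : B, ∑ y : Fin n → B, f (Fin.cons z y) := by
  rw [← (Fin.consEquiv (fun _ : Fin (n + 1) => B)).sum_comp, Fintype.sum_prod_type]
  rfl

/-- Splitting off the first step of a trajectory turns the transition out of it into the
initial distribution of the remaining trajectory. -/
lemma pTraj_cons {S A : Type} (n : ℕ) (p₁ : S → ℝ) (P : S → A → S → ℝ)
    (q : ℕ → S → A → ℝ) (z : S × A) (y : Fin n → S × A) :
    pTraj (n + 1) p₁ P q (Fin.cons z y) =
      p₁ z.1 * q 1 z.1 z.2 * pTraj n (P z.1 z.2) P (fun k => q (k + 1)) y := by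
  unfold pTraj
  rw [Fin.prod_univ_succ, Fin.prod_univ_succ]
  rcases n with _ | n
  · simp
  · simp only [Nat.zero_lt_succ, dite_true, Fin.val_zero, Fin.val_succ, Fin.cons_zero,
      Fin.cons_succ, Nat.add_lt_add_iff_right, zero_add, Fin.zero_eta]
    have h1 : ∀ (m : ℕ) (h : m + 1 < n + 1 + 1),
        (Fin.cons z y : Fin (n + 1 + 1) → S × A) ⟨m + 1, h⟩ = y ⟨m, by omega⟩ := fun _ _ => rfl
    simp only [h1, lt_add_iff_pos_left, Nat.zero_lt_succ, dite_true, Fin.zero_eta]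
    ring

lemma ret_cons {S A : Type} (n : ℕ) (R : S → A → ℝ) (z : S × A) (y : Fin n → S × A) :
    ret (n + 1) R (Fin.cons z y) = R z.1 z.2 + ret n R y := by
  simp [ret, Fin.sum_univ_succ]

lemma pTraj_mul_exp_ret_cons {S A : Type} (n : ℕ) (p₁ : S → ℝ) (P : S → A → S → ℝ)
    (R : S → A → ℝ) (q : ℕ → S → A → ℝ) (z : S × A) (y : Fin n → S × A) :
    pTraj (n + 1) p₁ P q (Fin.cons z y) * Real.exp (ret (n + 1) R (Fin.cons z y)) =
      p₁ z.1 * q 1 z.1 z.2 * Real.exp (R z.1 z.2) *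
        (pTraj n (P z.1 z.2) P (fun k => q (k + 1)) y * Real.exp (ret n R y)) := by
  rw [pTraj_cons, ret_cons, Real.exp_add]
  ring

lemma sum_mul_exp_pos {X : Type} [Fintype X] {u v : X → ℝ} (hu : ∀ x, 0 ≤ u x)
    (hsum : ∑ x, u x = 1) : 0 < ∑ x, u x * Real.exp (v x) := by
  refine (Finset.sum_nonneg fun x _ => mul_nonneg (hu x) (Real.exp_pos _).le).lt_of_ne' ?_
  intro h
  rw [Finset.sum_eq_zero_iff_of_nonneg
    fun x _ => mul_nonneg (hu x) (Real.exp_pos _).le] at h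
  have h0 : ∀ x, u x = 0 := fun x =>
    (mul_eq_zero.1 (h x (Finset.mem_univ x))).resolve_right (Real.exp_pos _).ne'
  simp [h0] at hsum

lemma exp_softQ {S A : Type} [Fintype S] {P : S → A → S → ℝ} (hP : ∀ s a s', 0 ≤ P s a s')
    (hPsum : ∀ s a, ∑ s' : S, P s a s' = 1) {R : S → A → ℝ} {W : S → ℝ} {r : ℝ} {s : S} {a : A}
    (hr : r = R s a + Real.log (∑ s' : S, P s a s' * Real.exp (W s'))) :
    Real.exp r = Real.exp (R s a) * ∑ s' : S, P s a s' * Real.exp (W s') := by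
  rw [hr, Real.exp_add, Real.exp_log (sum_mul_exp_pos (hP s a) (hPsum s a))]

/-- The soft value function computes the total tilted weight of all trajectories. -/
lemma sum_pTraj_mul_exp_ret {S A : Type} [Fintype S] [Fintype A]
    {P : S → A → S → ℝ} (hP : ∀ s a s', 0 ≤ P s a s')
    (hPsum : ∀ s a, ∑ s' : S, P s a s' = 1) (R : S → A → ℝ) (n : ℕ) :
    ∀ (p₁ : S → ℝ), ∑ s, p₁ s = 1 → ∀ (π : ℕ → S → A → ℝ), IsPolicy n π →
    ∀ (V : ℕ → S → ℝ) (Q : ℕ → S → A → ℝ), (∀ s, V (n + 1) s = 0) →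
    (∀ t ∈ Finset.Icc 1 n, ∀ (s : S) (a : A),
      Q t s a = R s a + Real.log (∑ s' : S, P s a s' * Real.exp (V (t + 1) s'))) →
    (∀ t ∈ Finset.Icc 1 n, ∀ s : S,
      V t s = Real.log (∑ a : A, π t s a * Real.exp (Q t s a))) →
    ∑ x : Fin n → S × A, pTraj n p₁ P π x * Real.exp (ret n R x) =
      ∑ s, p₁ s * Real.exp (V 1 s) := by
  induction n with
  | zero =>
    intro p₁ hp π _ V Q hV0 _ _
    simp only [zero_add] at hV0
    simp [pTraj, ret, hV0, hp]
  | succ n ih =>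
    intro p₁ hp π hπ V Q hVT hQ hV
    have hmem : (1 : ℕ) ∈ Finset.Icc 1 (n + 1) := by simp
    have hshift : ∀ t ∈ Finset.Icc 1 n, t + 1 ∈ Finset.Icc 1 (n + 1) := by
      intro t ht
      simp only [Finset.mem_Icc] at ht ⊢
      omega
    rw [sum_fin_succ_cons, Fintype.sum_prod_type]
    refine Finset.sum_congr rfl fun s _ => ?_
    rw [hV 1 hmem s, Real.exp_log (sum_mul_exp_pos (hπ 1 hmem s).1 (hπ 1 hmem s).2),
      Finset.mul_sum]
    refine Finset.sum_congr rfl fun a _ => ?_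
    simp only [pTraj_mul_exp_ret_cons]
    rw [← Finset.mul_sum, ih (P s a) (hPsum s a) (fun k => π (k + 1))
      (fun t ht => hπ (t + 1) (hshift t ht)) (fun k => V (k + 1)) (fun k => Q (k + 1)) hVT
      (fun t ht => hQ (t + 1) (hshift t ht)) (fun t ht => hV (t + 1) (hshift t ht)),
      exp_softQ hP hPsum (hQ 1 hmem s a)]
    ring

/-- Among trajectories beginning with a given prefix, the tilted weight of those taking action
`a` next is proportional to `π_t(s_t,a) · exp Q_t(s_t,a)`. -/
lemma exists_sum_prefix_eq_mul {S A : Type} [Fintype S] [Fintype A] [DecidableEq S]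
    [DecidableEq A] {P : S → A → S → ℝ} (hP : ∀ s a s', 0 ≤ P s a s')
    (hPsum : ∀ s a, ∑ s' : S, P s a s' = 1) (R : S → A → ℝ) (k : ℕ) :
    ∀ (n : ℕ), k < n → ∀ (p₁ : S → ℝ) (π : ℕ → S → A → ℝ), IsPolicy n π →
    ∀ (V : ℕ → S → ℝ) (Q : ℕ → S → A → ℝ), (∀ s, V (n + 1) s = 0) →
    (∀ t ∈ Finset.Icc 1 n, ∀ (s : S) (a : A),
      Q t s a = R s a + Real.log (∑ s' : S, P s a s' * Real.exp (V (t + 1) s'))) →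
    (∀ t ∈ Finset.Icc 1 n, ∀ s : S,
      V t s = Real.log (∑ a : A, π t s a * Real.exp (Q t s a))) →
    ∀ (σ : ℕ → S) (α : ℕ → A), ∃ C : ℝ, ∀ a : A,
      (∑ x : Fin n → S × A,
        if (∀ j : Fin n, j.1 ≤ k → (x j).1 = σ (j.1 + 1)) ∧
            (∀ j : Fin n, j.1 < k → (x j).2 = α (j.1 + 1)) ∧
            (∀ j : Fin n, j.1 = k → (x j).2 = a)
        then pTraj n p₁ P π x * Real.exp (ret n R x) else 0) =
      C * (π (k + 1) (σ (k + 1)) a * Real.exp (Q (k + 1) (σ (k + 1)) a)) := by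
  induction k with
  | zero =>
    rintro (_ | n) hn p₁ π hπ V Q hVT hQ hV σ α
    · omega
    have hmem : (1 : ℕ) ∈ Finset.Icc 1 (n + 1) := by simp
    have hshift : ∀ t ∈ Finset.Icc 1 n, t + 1 ∈ Finset.Icc 1 (n + 1) := by
      intro t ht
      simp only [Finset.mem_Icc] at ht ⊢
      omega
    refine ⟨p₁ (σ 1), fun a => ?_⟩
    rw [sum_fin_succ_cons, Finset.sum_eq_single (σ 1, a)]
    · simp only [pTraj_mul_exp_ret_cons]
      rw [exp_softQ hP hPsum (hQ 1 hmem (σ 1) a)]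
      simp only [Fin.forall_fin_succ]
      simp only [Fin.val_zero, Fin.val_succ, Fin.cons_zero, Fin.cons_succ, zero_add,
        Nat.add_eq_zero_iff, Nat.le_zero, one_ne_zero, and_false, false_imp_iff, imp_self,
        implies_true, and_self, not_lt_zero, if_true, le_refl]
      rw [← Finset.mul_sum, sum_pTraj_mul_exp_ret hP hPsum R n (P (σ 1) a) (hPsum _ _)
        (fun k => π (k + 1)) (fun t ht => hπ (t + 1) (hshift t ht)) (fun k => V (k + 1))
        (fun k => Q (k + 1)) hVT
        (fun t ht => hQ (t + 1) (hshift t ht)) (fun t ht => hV (t + 1) (hshift t ht))]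
      ring
    · intro z _ hz
      refine Finset.sum_eq_zero fun y _ => if_neg ?_
      rintro ⟨h1, -, h3⟩
      exact hz (Prod.ext (h1 0 le_rfl) (h3 0 rfl))
    · simp
  | succ k ih =>
    rintro (_ | n) hn p₁ π hπ V Q hVT hQ hV σ α
    · omega
    have hshift : ∀ t ∈ Finset.Icc 1 n, t + 1 ∈ Finset.Icc 1 (n + 1) := by
      intro t ht
      simp only [Finset.mem_Icc] at ht ⊢
      omega
    obtain ⟨C, hC⟩ := ih n (by omega) (P (σ 1) (α 1)) (fun k => π (k + 1))
      (fun t ht => hπ (t + 1) (hshift t ht)) (fun k => V (k + 1))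
      (fun k => Q (k + 1)) hVT (fun t ht => hQ (t + 1) (hshift t ht))
      (fun t ht => hV (t + 1) (hshift t ht)) (fun k => σ (k + 1)) (fun k => α (k + 1))
    refine ⟨p₁ (σ 1) * π 1 (σ 1) (α 1) * Real.exp (R (σ 1) (α 1)) * C, fun a => ?_⟩
    rw [sum_fin_succ_cons, Finset.sum_eq_single (σ 1, α 1)]
    · rw [mul_assoc _ C, ← hC a, Finset.mul_sum]
      refine Finset.sum_congr rfl fun y _ => ?_
      rw [mul_ite, mul_zero, pTraj_mul_exp_ret_cons]
      refine if_congr ?_ rfl rfl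
      simp only [Fin.forall_fin_succ]
      simp
    · intro z _ hz
      refine Finset.sum_eq_zero fun y _ => if_neg ?_
      rintro ⟨h1, h2, -⟩
      exact hz (Prod.ext (h1 0 (Nat.zero_le _)) (h2 0 (Nat.succ_pos _)))
    · simp

/-- Markov property of the posterior action conditional: under the fully
tilted weights `ρ(h) = p_π(h)·exp R(h)`, the conditional probability of `A_t = a` given that
the trajectory begins with a fixed positive-probability prefix `(s_1,a_1,…,s_{t−1},a_{t−1},s_t)`
(encoded by `σ j = s_j` for `j ≤ t` and `α j = a_j` for `j ≤ t−1`) equals `q^post_t(s_t,a)`;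
in particular it depends on the prefix only through `s_t = σ t`. -/
theorem stmt_5 {S A : Type} [Fintype S] [Fintype A] [DecidableEq S] [DecidableEq A]
    [Nonempty S] [Nonempty A]
    (T : ℕ) (hT : 1 ≤ T)
    (p₁ : S → ℝ) (hp₁ : ∀ s, 0 ≤ p₁ s) (hp₁sum : (∑ s : S, p₁ s) = 1)
    (P : S → A → S → ℝ) (hP : ∀ s a s', 0 ≤ P s a s')
    (hPsum : ∀ s a, (∑ s' : S, P s a s') = 1)
    (R : S → A → ℝ)
    (π : ℕ → S → A → ℝ) (hπ : IsPolicy T π) (hπpos : FullSupport T π)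
    (V : ℕ → S → ℝ) (Q : ℕ → S → A → ℝ)
    (hVT : ∀ s, V (T + 1) s = 0)
    (hQ : ∀ t ∈ Finset.Icc 1 T, ∀ (s : S) (a : A),
      Q t s a = R s a + Real.log (∑ s' : S, P s a s' * Real.exp (V (t + 1) s')))
    (hV : ∀ t ∈ Finset.Icc 1 T, ∀ s : S,
      V t s = Real.log (∑ a : A, π t s a * Real.exp (Q t s a)))
    (t : ℕ) (ht1 : 1 ≤ t) (ht2 : t ≤ T)
    (σ : ℕ → S) (α : ℕ → A)
    (hpre : 0 < ∑ x ∈ Finset.univ.filter (fun x : Fin T → S × A =>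
        (∀ j : Fin T, j.1 + 1 ≤ t → (x j).1 = σ (j.1 + 1)) ∧
          (∀ j : Fin T, j.1 + 1 ≤ t - 1 → (x j).2 = α (j.1 + 1))),
      pTraj T p₁ P π x)
    (a : A) :
    (∑ x ∈ Finset.univ.filter (fun x : Fin T → S × A =>
          ((∀ j : Fin T, j.1 + 1 ≤ t → (x j).1 = σ (j.1 + 1)) ∧
            (∀ j : Fin T, j.1 + 1 ≤ t - 1 → (x j).2 = α (j.1 + 1))) ∧
            (x ⟨t - 1, by omega⟩).2 = a),
        pTraj T p₁ P π x * Real.exp (ret T R x)) /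
      (∑ x ∈ Finset.univ.filter (fun x : Fin T → S × A =>
          (∀ j : Fin T, j.1 + 1 ≤ t → (x j).1 = σ (j.1 + 1)) ∧
            (∀ j : Fin T, j.1 + 1 ≤ t - 1 → (x j).2 = α (j.1 + 1))),
        pTraj T p₁ P π x * Real.exp (ret T R x)) =
      π t (σ t) a * Real.exp (Q t (σ t) a - V t (σ t)) := by
  obtain ⟨k, rfl⟩ : ∃ k, t = k + 1 := ⟨t - 1, by omega⟩
  obtain ⟨C, hC⟩ := exists_sum_prefix_eq_mul hP hPsum R k T (by omega) p₁ π hπ V Q hVT hQ hV σ α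
  have hmem : k + 1 ∈ Finset.Icc 1 T := Finset.mem_Icc.2 ⟨ht1, ht2⟩
  set E := Finset.univ.filter (fun x : Fin T → S × A =>
    (∀ j : Fin T, j.1 + 1 ≤ k + 1 → (x j).1 = σ (j.1 + 1)) ∧
      (∀ j : Fin T, j.1 + 1 ≤ k + 1 - 1 → (x j).2 = α (j.1 + 1))) with hE
  have hnum : ∀ b : A, ∑ x ∈ E.filter (fun x => (x ⟨k + 1 - 1, by omega⟩).2 = b),
      pTraj T p₁ P π x * Real.exp (ret T R x) =
        C * (π (k + 1) (σ (k + 1)) b * Real.exp (Q (k + 1) (σ (k + 1)) b)) := by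
    intro b
    rw [← hC b, hE, Finset.filter_filter, Finset.sum_filter]
    refine Finset.sum_congr rfl fun x _ => if_congr ?_ rfl rfl
    rw [and_assoc]
    refine and_congr (by simp) (and_congr (by simp) ⟨?_, fun h => h _ rfl⟩)
    rintro h ⟨j, hj⟩ rfl
    exact h
  have hden : ∑ x ∈ E, pTraj T p₁ P π x * Real.exp (ret T R x) =
      C * Real.exp (V (k + 1) (σ (k + 1))) := by
    rw [← Finset.sum_fiberwise E (fun x => (x ⟨k + 1 - 1, by omega⟩).2),
      Finset.sum_congr rfl fun b _ => hnum b, ← Finset.mul_sum, hV _ hmem,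
      Real.exp_log (sum_mul_exp_pos (hπ _ hmem _).1 (hπ _ hmem _).2)]
  have hnonneg : ∀ x, 0 ≤ pTraj T p₁ P π x := by
    intro x
    unfold pTraj
    refine mul_nonneg (mul_nonneg ?_ (Finset.prod_nonneg fun i _ => ?_))
      (Finset.prod_nonneg fun i _ => ?_)
    · split_ifs
      exacts [hp₁ _, zero_le_one]
    · exact (hπ _ (Finset.mem_Icc.2 ⟨by omega, i.2⟩) _).1 _
    · split_ifs
      exacts [hP _ _ _, zero_le_one]
  have hC0 : C ≠ 0 := by
    rintro rfl
    rw [zero_mul, Finset.sum_eq_zero_iff_of_nonneg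
      fun x _ => mul_nonneg (hnonneg x) (Real.exp_pos _).le] at hden
    exact hpre.ne' (Finset.sum_eq_zero fun x hx =>
      (mul_eq_zero.1 (hden x hx)).resolve_right (Real.exp_pos _).ne')
  rw [hden, ← Finset.filter_filter, hnum a, Real.exp_sub]
  field_simp
end
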